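/- Consider the power network η̇ = Dᵀω, Mω̇ = u − DΓ(V)sin(η) − Aω − P^l(t), TV̇ = −E(η)V + Ē_fd with time-varying demand P^l(t) = Π₁σ₁ + Q⁻¹1ₙR₂σ₂(t), where Π₁ is a constant diagonal matrix, σ₁ ∈ ℝ is constant, σ₂ : ℝ → ℝ^r satisfies σ̇₂ = S₂σ₂ with S₂ ∈ ℝ^{r×r} skew-symmetric and invertible, R₂ ∈ ℝ^{1×r}, and the pair (R₂, S₂) is observable. The controllers are θ̇₁ = −L_comm·θ₁ − Q⁻¹ω, θ̇₂ = (Iₙ ⊗ S₂)θ₂ − (Iₙ ⊗ R₂ᵀ)Q⁻¹ω, u = Q⁻¹θ₁ + Q⁻¹(Iₙ ⊗ R₂)θ₂, where L_comm is the Laplacian of a connected undirected communication graph and Q is diagonal positive definite. Suppose the regulator equations admit a solution: there exist constants η̄ ∈ range(Dᵀ) and V̄ ∈ ℝⁿ with positive entries such that DΓ(V̄)sin(η̄) = (Q⁻¹1ₙ1ₙᵀ/(1ₙᵀQ⁻¹1ₙ) − I)P^l(t) for all t, E(η̄)V̄ = Ē_fd, η̄ ∈ (−π/2, π/2)^m,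 and E(η̄) − diag(V̄)⁻¹|D|Γ(V̄)diag(sin(η̄))diag(cos(η̄))⁻¹diag(sin(η̄))|D|ᵀdiag(V̄)⁻¹ is positive definite. Then solutions of the closed loop starting sufficiently close to the steady state satisfy ω(t) → 0 and u(t) − ū(t) → 0 as t → ∞, where ū(t) = Q⁻¹·(1ₙ1ₙᵀP^l(t))/(1ₙᵀQ⁻¹1ₙ) is the optimal time-varying feedforward input. -/

import Mathlib

open Matrix Real Filter Topology Set

noncomputable section

/-- `Vec n` is `ℝⁿ`. -/
abbrev Vec (n : ℕ) := Fin n → ℝ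

/-- Incidence matrix of the (undirected, arbitrarily oriented) graph whose `m` edges have
endpoints `ep1 k` (positive end) and `ep2 k` (negative end). -/
def incD {n m : ℕ} (ep1 ep2 : Fin m → Fin n) : Matrix (Fin n) (Fin m) ℝ :=
  Matrix.of fun i k => if i = ep1 k then 1 else if i = ep2 k then -1 else 0

/-- `Γ(V) = diag(γ₁,…,γ_m)`, `γ_k = V_i V_j B_{ij}` for edge `k = {i,j}`. -/
def Gam {n m : ℕ} (ep1 ep2 : Fin m → Fin n) (B : Fin m → ℝ) (V : Vec n) :
    Matrix (Fin m) (Fin m) ℝ :=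
  Matrix.diagonal fun k => V (ep1 k) * V (ep2 k) * B k

/-- The matrix `E(η)`. -/
def Emat {n m : ℕ} (ep1 ep2 : Fin m → Fin n) (B : Fin m → ℝ)
    (Bii Xd Xd' : Vec n) (η : Vec m) : Matrix (Fin n) (Fin n) ℝ :=
  Matrix.of fun i j =>
    if i = j then (1 - Bii i * (Xd i - Xd' i)) / (Xd i - Xd' i)
    else -∑ k, (if (ep1 k = i ∧ ep2 k = j) ∨ (ep1 k = j ∧ ep2 k = i)
      then B k * Real.cos (η k) else 0)

/-- The diagonal matrix `F`. -/
def Fmat {n : ℕ} (Bii Xd Xd' : Vec n) : Matrix (Fin n) (Fin n) ℝ :=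
  Matrix.diagonal fun i => (1 - Bii i * (Xd i - Xd' i)) / (Xd i - Xd' i)

/-- componentwise sine -/
def sinv {m : ℕ} (η : Vec m) : Vec m := fun k => Real.sin (η k)
/-- componentwise cosine -/
def cosv {m : ℕ} (η : Vec m) : Vec m := fun k => Real.cos (η k)

/-- The storage function `W₂` with reference point `(ηb, Vb)`. -/
def W2 {n m : ℕ} (ep1 ep2 : Fin m → Fin n) (B : Fin m → ℝ) (Bii Xd Xd' : Vec n)
    (Efd : Vec n) (ηb : Vec m) (Vb : Vec n) (η : Vec m) (V : Vec n) : ℝ :=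
  -((1 : Vec m) ⬝ᵥ (Gam ep1 ep2 B V).mulVec (cosv η))
    + (1 : Vec m) ⬝ᵥ (Gam ep1 ep2 B Vb).mulVec (cosv ηb)
    - ((Gam ep1 ep2 B Vb).mulVec (sinv ηb)) ⬝ᵥ (η - ηb)
    - Efd ⬝ᵥ (V - Vb)
    + (1 / 2) * (V ⬝ᵥ (Fmat Bii Xd Xd').mulVec V)
    - (1 / 2) * (Vb ⬝ᵥ (Fmat Bii Xd Xd').mulVec Vb)

/-- entrywise absolute value `|D|` of the incidence matrix. -/
def absD {n m : ℕ} (ep1 ep2 : Fin m → Fin n) : Matrix (Fin n) (Fin m) ℝ :=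
  Matrix.of fun i k => |incD ep1 ep2 i k|

/-- The matrix `E(η̄) − diag(V̄)⁻¹|D|Γ(V̄)diag(sin η̄)diag(cos η̄)⁻¹diag(sin η̄)|D|ᵀdiag(V̄)⁻¹`
appearing in Assumption 3. -/
def Schur {n m : ℕ} (ep1 ep2 : Fin m → Fin n) (B : Fin m → ℝ) (Bii Xd Xd' : Vec n)
    (ηb : Vec m) (Vb : Vec n) : Matrix (Fin n) (Fin n) ℝ :=
  Emat ep1 ep2 B Bii Xd Xd' ηb -
    (Matrix.diagonal fun i => (Vb i)⁻¹) * absD ep1 ep2 * Gam ep1 ep2 B Vb *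
      Matrix.diagonal (sinv ηb) * (Matrix.diagonal (cosv ηb))⁻¹ *
      Matrix.diagonal (sinv ηb) * (absD ep1 ep2)ᵀ * (Matrix.diagonal fun i => (Vb i)⁻¹)

theorem tendsto_comp_of_mapClusterPt {X Y : Type*} [TopologicalSpace X] [TopologicalSpace Y]
    {z : ℝ → X} {K : Set X} (hK : IsCompact K) (hz : ∀ t, 0 ≤ t → z t ∈ K) {φ : X → Y}
    (hφ : Continuous φ) {y : Y} (h : ∀ x, MapClusterPt x atTop z → φ x = y) :
    Tendsto (fun t => φ (z t)) atTop (𝓝 y) := by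
  rw [tendsto_nhds]
  intro U hU hy
  by_contra hne
  have hfreq : ∃ᶠ t in atTop, z t ∈ K ∩ φ ⁻¹' Uᶜ :=
    (Filter.not_eventually.mp hne).mp ((eventually_ge_atTop 0).mono
      fun t ht htU => ⟨hz t ht, htU⟩)
  obtain ⟨x, hx, hcl⟩ := (hK.inter_right
    (hU.isClosed_compl.preimage hφ)).exists_mapClusterPt_of_frequently hfreq
  exact hx.2 (by rw [h x hcl]; exact hy)

theorem eq_of_mapClusterPt_of_tendsto {X Y : Type*} [TopologicalSpace X] [TopologicalSpace Y]
    [T2Space Y] {z : ℝ → X} {φ : X → Y} (hφ : Continuous φ) {y : Y}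
    (h : Tendsto (fun t => φ (z t)) atTop (𝓝 y)) {x : X} (hx : MapClusterPt x atTop z) :
    φ x = y := by
  have h1 : MapClusterPt (φ x) atTop (φ ∘ z) := hx.continuousAt_comp hφ.continuousAt
  by_contra hne
  exact (h1.neBot.mono (inf_le_inf_left _ h)).ne (disjoint_nhds_nhds.mpr hne).eq_bot

/-- **Barbalat's lemma** along a trajectory of a continuous vector field that stays in a compact
set: if a scalar function of time converges and its derivative is a continuous function of the
state, then this derivative vanishes at every limit point of the trajectory. -/
theorem eq_zero_of_mapClusterPt_of_hasDerivAt {X : Type*} [NormedAddCommGroup X] [NormedSpace ℝ X]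
    {z : ℝ → X} {K : Set X} (hK : IsCompact K) (hz : ∀ t, 0 ≤ t → z t ∈ K)
    {F : X → X} (hF : Continuous F) (hzF : ∀ t, HasDerivAt z (F (z t)) t)
    {f : ℝ → ℝ} {a : X → ℝ} (ha : Continuous a) (hf : ∀ t, HasDerivAt f (a (z t)) t)
    {c : ℝ} (hfc : Tendsto f atTop (𝓝 c)) {x : X} (hx : MapClusterPt x atTop z) : a x = 0 := by
  refine eq_of_mapClusterPt_of_tendsto ha ?_ hx
  obtain ⟨C, hC⟩ := hK.exists_bound_of_continuousOn hF.continuousOn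
  have hC0 : 0 ≤ C := (norm_nonneg _).trans (hC _ (hz 0 le_rfl))
  rw [Metric.tendsto_atTop]
  intro ε hε
  obtain ⟨δ, hδ, haδ⟩ := Metric.uniformContinuousOn_iff.mp
    (hK.uniformContinuousOn_of_continuous ha.continuousOn) (ε / 2) (half_pos hε)
  set τ := δ / (2 * (C + 1)) with hτ
  have hτ0 : 0 < τ := by positivity
  have hCτ : C * τ < δ := by
    rw [hτ, ← mul_div_assoc, div_lt_iff₀ (by positivity)]
    nlinarith
  obtain ⟨N, hN⟩ := Metric.tendsto_atTop.mp hfc (τ * ε / 4) (by positivity)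
  refine ⟨max N 0, fun t ht => ?_⟩
  have htN : N ≤ t := (le_max_left _ _).trans ht
  have ht0 : 0 ≤ t := (le_max_right _ _).trans ht
  obtain ⟨s, hs, hslope⟩ := exists_hasDerivAt_eq_slope f (fun t => a (z t))
    (show t < t + τ by linarith) (fun u _ => (hf u).continuousAt.continuousWithinAt)
    (fun u _ => hf u)
  have hdist : dist (z t) (z s) < δ := by
    have := (convex_Ici (0:ℝ)).norm_image_sub_le_of_norm_hasDerivWithin_le
      (fun u _ => (hzF u).hasDerivWithinAt) (fun u hu => hC _ (hz u hu))
      (mem_Ici.mpr (ht0.trans hs.1.le)) (mem_Ici.mpr ht0)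
    rw [dist_eq_norm]
    refine this.trans_lt (lt_of_le_of_lt ?_ hCτ)
    gcongr
    rw [Real.norm_eq_abs, abs_le]
    constructor <;> linarith [hs.1, hs.2]
  have h1 := haδ _ (hz t ht0) _ (hz s (ht0.trans hs.1.le)) hdist
  have h2 := hN t htN
  have h3 := hN (t + τ) (by linarith)
  rw [Real.dist_eq, abs_lt] at h1 h2 h3
  have h4 : a (z s) * τ = f (t + τ) - f t := by
    rw [hslope, add_sub_cancel_left, div_mul_cancel₀ _ hτ0.ne']
  have h5 : a (z s) < ε / 2 := by
    by_contra hcon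
    nlinarith
  have h6 : -(ε / 2) < a (z s) := by
    by_contra hcon
    nlinarith
  rw [Real.dist_eq, abs_lt]
  constructor <;> linarith

/-- **Lyapunov stability.** -/
theorem exists_forall_dist_le_of_strict_min {X : Type*} [PseudoMetricSpace X] [ProperSpace X]
    {W : X → ℝ} (hW : Continuous W) {x₀ : X} {ρ : ℝ} (hρ : 0 < ρ)
    (hmin : ∀ x, dist x x₀ = ρ → W x₀ < W x) :
    ∃ ε > 0, ∀ z : ℝ → X, Continuous z → (∀ t, 0 ≤ t → W (z t) ≤ W (z 0)) →
      dist (z 0) x₀ < ε → ∀ t, 0 ≤ t → dist (z t) x₀ ≤ ρ := by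
  obtain ⟨μ, hμ, hμW⟩ : ∃ μ > W x₀, ∀ x ∈ Metric.sphere x₀ ρ, μ ≤ W x := by
    rcases (Metric.sphere x₀ ρ).eq_empty_or_nonempty with he | hne
    · exact ⟨W x₀ + 1, by simp, by simp [he]⟩
    · obtain ⟨x, hx, hxmin⟩ := (isCompact_sphere x₀ ρ).exists_isMinOn hne hW.continuousOn
      exact ⟨W x, hmin x hx, fun y hy => hxmin hy⟩
  obtain ⟨δ, hδ, hδW⟩ := Metric.eventually_nhds_iff.mp
    (hW.continuousAt.eventually_lt continuousAt_const hμ)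
  refine ⟨min δ ρ, lt_min hδ hρ, fun z hz hdec h0 t ht => ?_⟩
  by_contra! hcon
  obtain ⟨s, hs, hsρ⟩ := intermediate_value_Icc ht
    ((hz.dist continuous_const).continuousOn (s := Icc 0 t))
    (show ρ ∈ Icc (dist (z 0) x₀) (dist (z t) x₀) from
      ⟨(h0.trans_le (min_le_right _ _)).le, hcon.le⟩)
  exact absurd (hμW _ hsρ) (not_le.mpr ((hdec s hs.1).trans_lt
    (hδW (h0.trans_le (min_le_left _ _)))))

/-- Second derivative test for a strict local minimum, in terms of derivatives along lines. -/
theorem exists_forall_dist_le_lt_of_hasDerivAt {P : Type*} [NormedAddCommGroup P]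
    [NormedSpace ℝ P] [ProperSpace P] {f : P → ℝ} {g H : P → P → ℝ} {b : P}
    (hf : ∀ h (s : ℝ), HasDerivAt (fun s : ℝ => f (b + s • h)) (g (b + s • h) h) s)
    (hg : ∀ h (s : ℝ), HasDerivAt (fun s : ℝ => g (b + s • h) h) (H (b + s • h) h) s)
    (hgb : ∀ h, g b h = 0) (hH : Continuous fun p : P × P => H p.1 p.2)
    (hpos : ∀ h, h ≠ 0 → 0 < H b h) :
    ∃ ρ > 0, ∀ p, p ≠ b → dist p b ≤ ρ → f b < f p := by
  have hev : ∀ᶠ p in 𝓝 b, ∀ h ∈ Metric.sphere (0 : P) 1, 0 < H p h :=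
    (isCompact_sphere (0 : P) 1).eventually_forall_of_forall_eventually fun h hh =>
      hH.continuousAt.eventually_const_lt (hpos h (ne_zero_of_mem_unit_sphere ⟨h, hh⟩))
  obtain ⟨δ, hδ, hδH⟩ := Metric.eventually_nhds_iff.mp hev
  refine ⟨δ / 2, half_pos hδ, fun p hp hpb => ?_⟩
  set τ := ‖p - b‖ with hτ
  have hτ0 : 0 < τ := norm_pos_iff.mpr (sub_ne_zero.mpr hp)
  set h := τ⁻¹ • (p - b) with hh
  have hnorm : ‖h‖ = 1 := by
    rw [hh, norm_smul, norm_inv, norm_norm, inv_mul_cancel₀ hτ0.ne']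
  have hbp : b + τ • h = p := by
    rw [hh, smul_smul, mul_inv_cancel₀ hτ0.ne', one_smul, add_sub_cancel]
  have hHpos : ∀ s ∈ Icc 0 τ, 0 < H (b + s • h) h := fun s hs => by
    refine hδH ?_ h (by simpa using hnorm)
    rw [dist_eq_norm, add_sub_cancel_left, norm_smul, hnorm, mul_one, Real.norm_of_nonneg hs.1]
    rw [dist_eq_norm] at hpb
    linarith [hs.2]
  have hgmono : StrictMonoOn (fun s : ℝ => g (b + s • h) h) (Icc 0 τ) :=
    strictMonoOn_of_deriv_pos (convex_Icc _ _)
      (fun s _ => (hg h s).continuousAt.continuousWithinAt) fun s hs => by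
        rw [(hg h s).deriv]; exact hHpos s (interior_subset hs)
  have hfmono : StrictMonoOn (fun s : ℝ => f (b + s • h)) (Icc 0 τ) :=
    strictMonoOn_of_deriv_pos (convex_Icc _ _)
      (fun s _ => (hf h s).continuousAt.continuousWithinAt) fun s hs => by
        rw [interior_Icc] at hs
        rw [(hf h s).deriv]
        simpa [hgb] using hgmono (left_mem_Icc.mpr hτ0.le) (Ioo_subset_Icc_self hs) hs.1
  simpa [hbp] using hfmono (left_mem_Icc.mpr hτ0.le) (right_mem_Icc.mpr hτ0.le) hτ0

section Incidence

variable {n m : ℕ} (ep1 ep2 : Fin m → Fin n)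

theorem incD_transpose_mulVec {ep1 ep2 : Fin m → Fin n} (hep : ∀ k, ep1 k ≠ ep2 k) (ω : Vec n)
    (k : Fin m) : ((incD ep1 ep2)ᵀ *ᵥ ω) k = ω (ep1 k) - ω (ep2 k) := by
  have h : ∀ i, incD ep1 ep2 i k * ω i =
      (if i = ep1 k then ω i else 0) - (if i = ep2 k then ω i else 0) := fun i => by
    have := hep k
    simp only [incD, of_apply]
    grind
  simp [mulVec, dotProduct, transpose_apply, h]

theorem absD_transpose_mulVec {ep1 ep2 : Fin m → Fin n} (hep : ∀ k, ep1 k ≠ ep2 k) (v : Vec n)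
    (k : Fin m) : ((absD ep1 ep2)ᵀ *ᵥ v) k = v (ep1 k) + v (ep2 k) := by
  have h : ∀ i, absD ep1 ep2 i k * v i =
      (if i = ep1 k then v i else 0) + (if i = ep2 k then v i else 0) := fun i => by
    have := hep k
    simp only [absD, incD, of_apply]
    grind
  simp [mulVec, dotProduct, transpose_apply, h, Finset.sum_add_distrib]

theorem sum_incD_mulVec {ep1 ep2 : Fin m → Fin n} (hep : ∀ k, ep1 k ≠ ep2 k) (g : Vec m) :
    ∑ i, (incD ep1 ep2 *ᵥ g) i = 0 := by
  have h : (1 : Vec n) ⬝ᵥ (incD ep1 ep2 *ᵥ g) = ((incD ep1 ep2)ᵀ *ᵥ 1) ⬝ᵥ g := by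
    rw [dotProduct_mulVec, mulVec_transpose]
  have h1 : (incD ep1 ep2)ᵀ *ᵥ (1 : Vec n) = 0 := by
    ext k
    simp [incD_transpose_mulVec hep]
  simpa [h1, dotProduct] using h

theorem Emat_apply {ep1 ep2 : Fin m → Fin n} (hep : ∀ k, ep1 k ≠ ep2 k) (B : Fin m → ℝ)
    (Bii Xd Xd' : Vec n) (η : Vec m) (i j : Fin n) :
    Emat ep1 ep2 B Bii Xd Xd' η i j = Fmat Bii Xd Xd' i j - ∑ k, B k * Real.cos (η k) *
      ((if i = ep1 k then if j = ep2 k then 1 else 0 else 0) +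
        (if i = ep2 k then if j = ep1 k then 1 else 0 else 0)) := by
  simp only [Emat, Fmat, of_apply, diagonal_apply]
  split_ifs with hij
  · rw [Finset.sum_eq_zero, sub_zero]
    intro k _
    have := hep k
    grind
  · rw [zero_sub, neg_inj]
    refine Finset.sum_congr rfl fun k _ => ?_
    have := hep k
    grind

theorem Emat_mulVec {ep1 ep2 : Fin m → Fin n} (hep : ∀ k, ep1 k ≠ ep2 k) (B : Fin m → ℝ)
    (Bii Xd Xd' : Vec n) (η : Vec m) (V : Vec n) (i : Fin n) :
    (Emat ep1 ep2 B Bii Xd Xd' η *ᵥ V) i = Fmat Bii Xd Xd' i i * V i -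
      ∑ k, B k * Real.cos (η k) *
        ((if i = ep1 k then V (ep2 k) else 0) + (if i = ep2 k then V (ep1 k) else 0)) := by
  have h1 : (Fmat Bii Xd Xd' *ᵥ V) i = Fmat Bii Xd Xd' i i * V i := by
    simp [Fmat, mulVec_diagonal]
  rw [← h1]
  simp only [mulVec, dotProduct, Emat_apply hep, sub_mul, Finset.sum_sub_distrib, Finset.sum_mul]
  rw [Finset.sum_comm]
  congr 1
  refine Finset.sum_congr rfl fun k _ => ?_
  simp only [mul_assoc, ← Finset.mul_sum, add_mul, Finset.sum_add_distrib]
  split_ifs <;> simp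

theorem dotProduct_Emat_mulVec {ep1 ep2 : Fin m → Fin n} (hep : ∀ k, ep1 k ≠ ep2 k)
    (B : Fin m → ℝ) (Bii Xd Xd' : Vec n) (η : Vec m) (v V : Vec n) :
    v ⬝ᵥ (Emat ep1 ep2 B Bii Xd Xd' η *ᵥ V) = ∑ i, Fmat Bii Xd Xd' i i * V i * v i -
      ∑ k, B k * Real.cos (η k) * (v (ep1 k) * V (ep2 k) + v (ep2 k) * V (ep1 k)) := by
  simp only [dotProduct, Emat_mulVec hep, mul_sub, Finset.sum_sub_distrib, Finset.mul_sum]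
  rw [Finset.sum_comm (s := Finset.univ (α := Fin n))]
  congr 1
  · exact Finset.sum_congr rfl fun i _ => by ring
  · refine Finset.sum_congr rfl fun k _ => ?_
    simp only [mul_add, Finset.sum_add_distrib, mul_ite, mul_zero]
    simp
    ring

end Incidence

section Potential

variable {n m : ℕ} (ep1 ep2 : Fin m → Fin n) (B : Fin m → ℝ) (Bii Xd Xd' Efd : Vec n)
  (ηb : Vec m) (Vb : Vec n)

/-- The partial gradient of `W2` with respect to the angles. -/
def gradAngle (η : Vec m) (V : Vec n) : Vec m :=
  Gam ep1 ep2 B V *ᵥ sinv η - Gam ep1 ep2 B Vb *ᵥ sinv ηb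

/-- The partial gradient of `W2` with respect to the voltages. -/
def gradVolt (η : Vec m) (V : Vec n) : Vec n :=
  Emat ep1 ep2 B Bii Xd Xd' η *ᵥ V - Efd

/-- The Hessian quadratic form of `W2` at `(η, V)` in the direction `(x, v)`. -/
def hessW2 (η : Vec m) (V : Vec n) (x : Vec m) (v : Vec n) : ℝ :=
  ∑ k, B k * (Real.cos (η k) * V (ep1 k) * V (ep2 k) * x k ^ 2
      + 2 * Real.sin (η k) * (v (ep1 k) * V (ep2 k) + V (ep1 k) * v (ep2 k)) * x k
      - 2 * Real.cos (η k) * v (ep1 k) * v (ep2 k))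
    + ∑ i, Fmat Bii Xd Xd' i i * v i ^ 2

theorem continuous_hessW2 : Continuous fun p : (Vec m × Vec n) × (Vec m × Vec n) =>
    hessW2 ep1 ep2 B Bii Xd Xd' p.1.1 p.1.2 p.2.1 p.2.2 := by
  unfold hessW2
  fun_prop

theorem gradAngle_apply (η : Vec m) (V : Vec n) (k : Fin m) :
    gradAngle ep1 ep2 B ηb Vb η V k = B k * (V (ep1 k) * V (ep2 k) * Real.sin (η k)
      - Vb (ep1 k) * Vb (ep2 k) * Real.sin (ηb k)) := by
  simp [gradAngle, Gam, mulVec_diagonal, sinv]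
  ring

@[fun_prop]
theorem continuous_gradAngle : Continuous fun p : Vec m × Vec n =>
    gradAngle ep1 ep2 B ηb Vb p.1 p.2 := by
  refine continuous_pi fun k => ?_
  simp only [gradAngle_apply]
  fun_prop

theorem hasDerivAt_gradAngle {η : ℝ → Vec m} {V : ℝ → Vec n} {x : Vec m} {v : Vec n} {t : ℝ}
    (hη : HasDerivAt η x t) (hV : HasDerivAt V v t) (k : Fin m) :
    HasDerivAt (fun s => gradAngle ep1 ep2 B ηb Vb (η s) (V s) k)
      (B k * ((v (ep1 k) * V t (ep2 k) + V t (ep1 k) * v (ep2 k)) * Real.sin (η t k)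
        + V t (ep1 k) * V t (ep2 k) * (Real.cos (η t k) * x k))) t := by
  simp only [gradAngle_apply]
  rw [hasDerivAt_pi] at hη hV
  exact ((((hV _).mul (hV _)).mul (hη k).sin).sub_const _).const_mul _

theorem gradAngle_dotProduct_add_gradVolt_dotProduct {ep1 ep2 : Fin m → Fin n}
    (hep : ∀ k, ep1 k ≠ ep2 k) (η : Vec m) (V : Vec n) (x : Vec m) (v : Vec n) :
    gradAngle ep1 ep2 B ηb Vb η V ⬝ᵥ x + gradVolt ep1 ep2 B Bii Xd Xd' Efd η V ⬝ᵥ v =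
      ∑ k, B k * ((V (ep1 k) * V (ep2 k) * Real.sin (η k)
          - Vb (ep1 k) * Vb (ep2 k) * Real.sin (ηb k)) * x k
        - Real.cos (η k) * (v (ep1 k) * V (ep2 k) + V (ep1 k) * v (ep2 k)))
      + ∑ i, (Fmat Bii Xd Xd' i i * V i - Efd i) * v i := by
  rw [gradVolt, sub_dotProduct, dotProduct_comm _ v, dotProduct_Emat_mulVec hep]
  simp only [dotProduct, gradAngle_apply, mul_sub, sub_mul, Finset.sum_sub_distrib, mul_assoc]
  have h : ∀ k, B k * (Real.cos (η k) * (v (ep1 k) * V (ep2 k) + v (ep2 k) * V (ep1 k))) =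
      B k * (Real.cos (η k) * (v (ep1 k) * V (ep2 k) + V (ep1 k) * v (ep2 k))) := fun k => by ring
  simp only [h]
  ring

theorem hasDerivAt_W2 {ep1 ep2 : Fin m → Fin n} (hep : ∀ k, ep1 k ≠ ep2 k)
    {η : ℝ → Vec m} {V : ℝ → Vec n} {x : Vec m} {v : Vec n} {t : ℝ}
    (hη : HasDerivAt η x t) (hV : HasDerivAt V v t) :
    HasDerivAt (fun s => W2 ep1 ep2 B Bii Xd Xd' Efd ηb Vb (η s) (V s))
      (gradAngle ep1 ep2 B ηb Vb (η t) (V t) ⬝ᵥ x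
        + gradVolt ep1 ep2 B Bii Xd Xd' Efd (η t) (V t) ⬝ᵥ v) t := by
  rw [gradAngle_dotProduct_add_gradVolt_dotProduct B Bii Xd Xd' Efd ηb Vb hep]
  rw [hasDerivAt_pi] at hη hV
  have h1 : HasDerivAt (fun s => ∑ k, B k * (-(V s (ep1 k) * V s (ep2 k) * Real.cos (η s k))
        - Vb (ep1 k) * Vb (ep2 k) * Real.sin (ηb k) * (η s k - ηb k))
      + ∑ i, (1 / 2 * (V s i * (Fmat Bii Xd Xd' i i * V s i)) - Efd i * (V s i - Vb i))
      + ((1 : Vec m) ⬝ᵥ (Gam ep1 ep2 B Vb).mulVec (cosv ηb)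
        - (1 / 2) * (Vb ⬝ᵥ (Fmat Bii Xd Xd').mulVec Vb))) _ t :=
    ((HasDerivAt.fun_sum fun k _ => ((((hV (ep1 k)).mul (hV (ep2 k))).mul (hη k).cos).neg.sub
      (((hη k).sub_const (ηb k)).const_mul _)).const_mul (B k)).add
    (HasDerivAt.fun_sum fun i _ => (((hV i).mul ((hV i).const_mul _)).const_mul (1 / 2)).sub
      (((hV i).sub_const (Vb i)).const_mul (Efd i)))).add_const _
  convert h1 using 1
  · ext s
    simp only [W2, Fmat, Gam, mulVec_diagonal, dotProduct, sinv, cosv, diagonal_apply_eq,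
      Pi.one_apply, one_mul, Pi.sub_apply, mul_sub, Finset.sum_sub_distrib, mul_neg,
      Finset.sum_neg_distrib, Finset.mul_sum]
    have h (e : Vec m) (W : Vec n) (f : ℝ → ℝ) :
        ∑ k, W (ep1 k) * W (ep2 k) * B k * f (e k) =
          ∑ k, B k * (W (ep1 k) * W (ep2 k) * f (e k)) :=
      Finset.sum_congr rfl fun k _ => by ring
    have h' (e : Vec m) :
        ∑ k, Vb (ep1 k) * Vb (ep2 k) * B k * Real.sin (ηb k) * e k =
          ∑ k, B k * (Vb (ep1 k) * Vb (ep2 k) * Real.sin (ηb k) * e k) :=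
      Finset.sum_congr rfl fun k _ => by ring
    simp only [h, h']
    ring
  · congr 1
    · exact Finset.sum_congr rfl fun k _ => by simp only [Pi.mul_apply]; ring
    · exact Finset.sum_congr rfl fun i _ => by ring

theorem hasDerivAt_grad_line {ep1 ep2 : Fin m → Fin n} (hep : ∀ k, ep1 k ≠ ep2 k)
    (η x : Vec m) (V v : Vec n) (s : ℝ) :
    HasDerivAt (fun s : ℝ => gradAngle ep1 ep2 B ηb Vb (η + s • x) (V + s • v) ⬝ᵥ x
        + gradVolt ep1 ep2 B Bii Xd Xd' Efd (η + s • x) (V + s • v) ⬝ᵥ v)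
      (hessW2 ep1 ep2 B Bii Xd Xd' (η + s • x) (V + s • v) x v) s := by
  simp only [gradAngle_dotProduct_add_gradVolt_dotProduct B Bii Xd Xd' Efd ηb Vb hep, hessW2]
  have hη (k : Fin m) : HasDerivAt (fun s : ℝ => (η + s • x) k) (x k) s := by
    simpa using ((hasDerivAt_id s).mul_const (x k)).const_add (η k)
  have hV (i : Fin n) : HasDerivAt (fun s : ℝ => (V + s • v) i) (v i) s := by
    simpa using ((hasDerivAt_id s).mul_const (v i)).const_add (V i)
  refine HasDerivAt.add (HasDerivAt.fun_sum fun k _ => ?_) (HasDerivAt.fun_sum fun i _ => ?_)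
  · convert! (((((hV (ep1 k)).mul (hV (ep2 k))).mul (hη k).sin).sub_const
      (Vb (ep1 k) * Vb (ep2 k) * Real.sin (ηb k))).mul_const (x k)).sub
      ((hη k).cos.mul (((hV (ep2 k)).const_mul (v (ep1 k))).add
        ((hV (ep1 k)).mul_const (v (ep2 k))))) |>.const_mul (B k) using 1
    simp only [Pi.mul_apply, Pi.add_apply]
    ring
  · convert! (((hV i).const_mul (Fmat Bii Xd Xd' i i)).sub_const (Efd i)).mul_const (v i) using 1
    ring

theorem dotProduct_Schur_mulVec {ep1 ep2 : Fin m → Fin n} (hep : ∀ k, ep1 k ≠ ep2 k)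
    (hsec : ∀ k, Real.cos (ηb k) ≠ 0) (v : Vec n) :
    v ⬝ᵥ (Schur ep1 ep2 B Bii Xd Xd' ηb Vb *ᵥ v) =
      v ⬝ᵥ (Emat ep1 ep2 B Bii Xd Xd' ηb *ᵥ v) -
      ∑ k, Vb (ep1 k) * Vb (ep2 k) * B k * (Real.sin (ηb k) ^ 2 / Real.cos (ηb k)) *
        ((Vb (ep1 k))⁻¹ * v (ep1 k) + (Vb (ep2 k))⁻¹ * v (ep2 k)) ^ 2 := by
  have hcos : (diagonal (cosv ηb))⁻¹ = diagonal fun k => (Real.cos (ηb k))⁻¹ := by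
    refine inv_eq_left_inv ?_
    rw [diagonal_mul_diagonal, ← diagonal_one]
    congr 1
    ext k
    exact inv_mul_cancel₀ (hsec k)
  set w : Vec n := fun i => (Vb i)⁻¹ * v i with hw
  have hwv : (diagonal fun i => (Vb i)⁻¹) *ᵥ v = w := by
    ext i
    rw [mulVec_diagonal]
  rw [Schur, hcos, sub_mulVec, dotProduct_sub]
  congr 1
  simp only [← mulVec_mulVec, hwv]
  rw [dotProduct_mulVec, ← mulVec_transpose, diagonal_transpose, hwv, dotProduct_mulVec,
    ← mulVec_transpose]
  simp only [dotProduct, Gam, mulVec_diagonal, absD_transpose_mulVec hep, sinv]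
  refine Finset.sum_congr rfl fun k _ => ?_
  simp only [hw]
  ring

theorem hessW2_pos {ep1 ep2 : Fin m → Fin n} (hep : ∀ k, ep1 k ≠ ep2 k) (hB : ∀ k, 0 < B k)
    (hVb : ∀ i, 0 < Vb i) (hsec : ∀ k, 0 < Real.cos (ηb k))
    (hPD : (Schur ep1 ep2 B Bii Xd Xd' ηb Vb).PosDef) {x : Vec m} {v : Vec n}
    (h : (x, v) ≠ 0) : 0 < hessW2 ep1 ep2 B Bii Xd Xd' ηb Vb x v := by
  have key : hessW2 ep1 ep2 B Bii Xd Xd' ηb Vb x v =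
      ∑ k, Vb (ep1 k) * Vb (ep2 k) * B k * Real.cos (ηb k) *
        (x k + Real.sin (ηb k) / Real.cos (ηb k) *
          ((Vb (ep1 k))⁻¹ * v (ep1 k) + (Vb (ep2 k))⁻¹ * v (ep2 k))) ^ 2
      + v ⬝ᵥ (Schur ep1 ep2 B Bii Xd Xd' ηb Vb *ᵥ v) := by
    rw [dotProduct_Schur_mulVec B Bii Xd Xd' ηb Vb hep (fun k => (hsec k).ne'),
      dotProduct_Emat_mulVec hep, hessW2, sub_sub, add_sub_left_comm, ← Finset.sum_add_distrib,
      ← Finset.sum_sub_distrib, add_comm]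
    congr 1
    · exact Finset.sum_congr rfl fun i _ => by ring
    · refine Finset.sum_congr rfl fun k _ => ?_
      have := (hsec k).ne'
      have := (hVb (ep1 k)).ne'
      have := (hVb (ep2 k)).ne'
      field_simp
      ring
  rw [key]
  have hterm : ∀ k, 0 < Vb (ep1 k) * Vb (ep2 k) * B k * Real.cos (ηb k) := fun k =>
    mul_pos (mul_pos (mul_pos (hVb _) (hVb _)) (hB k)) (hsec k)
  by_cases hv : v = 0
  · subst hv
    have hx : x ≠ 0 := by
      rintro rfl
      exact h rfl
    obtain ⟨k, hk⟩ := Function.ne_iff.mp hx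
    simp only [Pi.zero_apply, mul_zero, add_zero, zero_dotProduct]
    refine Finset.sum_pos' (fun k _ => mul_nonneg (hterm k).le (sq_nonneg _))
      ⟨k, Finset.mem_univ _, mul_pos (hterm k) (sq_pos_of_ne_zero hk)⟩
  · refine add_pos_of_nonneg_of_pos
      (Finset.sum_nonneg fun k _ => mul_nonneg (hterm k).le (sq_nonneg _)) ?_
    simpa using hPD.dotProduct_mulVec_pos hv

theorem exists_forall_dist_le_W2_lt {ep1 ep2 : Fin m → Fin n} (hep : ∀ k, ep1 k ≠ ep2 k)
    (hB : ∀ k, 0 < B k) (hVb : ∀ i, 0 < Vb i) (hsec : ∀ k, 0 < Real.cos (ηb k))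
    (hPD : (Schur ep1 ep2 B Bii Xd Xd' ηb Vb).PosDef)
    (hEfd : Emat ep1 ep2 B Bii Xd Xd' ηb *ᵥ Vb = Efd) :
    ∃ ρ > 0, ∀ p : Vec m × Vec n, p ≠ (ηb, Vb) → dist p (ηb, Vb) ≤ ρ →
      W2 ep1 ep2 B Bii Xd Xd' Efd ηb Vb ηb Vb < W2 ep1 ep2 B Bii Xd Xd' Efd ηb Vb p.1 p.2 := by
  have hline₁ (h : Vec m × Vec n) (s : ℝ) :
      HasDerivAt (fun s : ℝ => ((ηb, Vb) + s • h).1) h.1 s := by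
    simpa using ((hasDerivAt_id s).smul_const h.1).const_add ηb
  have hline₂ (h : Vec m × Vec n) (s : ℝ) :
      HasDerivAt (fun s : ℝ => ((ηb, Vb) + s • h).2) h.2 s := by
    simpa using ((hasDerivAt_id s).smul_const h.2).const_add Vb
  have hf (h : Vec m × Vec n) (s : ℝ) :=
    hasDerivAt_W2 B Bii Xd Xd' Efd ηb Vb hep (hline₁ h s) (hline₂ h s)
  have hg (h : Vec m × Vec n) (s : ℝ) :=
    hasDerivAt_grad_line B Bii Xd Xd' Efd ηb Vb hep ηb h.1 Vb h.2 s
  exact exists_forall_dist_le_lt_of_hasDerivAt (P := Vec m × Vec n) (b := (ηb, Vb))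
    (f := fun p => W2 ep1 ep2 B Bii Xd Xd' Efd ηb Vb p.1 p.2)
    (g := fun p h => gradAngle ep1 ep2 B ηb Vb p.1 p.2 ⬝ᵥ h.1
        + gradVolt ep1 ep2 B Bii Xd Xd' Efd p.1 p.2 ⬝ᵥ h.2)
    (H := fun p h => hessW2 ep1 ep2 B Bii Xd Xd' p.1 p.2 h.1 h.2)
    hf hg (fun h => by simp [gradAngle, gradVolt, hEfd])
    (continuous_hessW2 ep1 ep2 B Bii Xd Xd')
    (fun h hh => hessW2_pos B Bii Xd Xd' ηb Vb hep hB hVb hsec hPD hh)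

end Potential

theorem dotProduct_mulVec_self_eq_zero_of_skew {r : ℕ} {S : Matrix (Fin r) (Fin r) ℝ}
    (hS : Sᵀ = -S) (x : Fin r → ℝ) : x ⬝ᵥ (S *ᵥ x) = 0 := by
  have h : x ⬝ᵥ (S *ᵥ x) = -(x ⬝ᵥ (S *ᵥ x)) := by
    conv_lhs => rw [dotProduct_mulVec, ← mulVec_transpose, hS, neg_mulVec, neg_dotProduct,
      dotProduct_comm]
  linarith

/-- The closed loop in deviation coordinates with respect to a solution of the regulator
equations; `L` is the communication Laplacian. -/
structure ErrorSystem (n m r : ℕ) where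
  ep1 : Fin m → Fin n
  ep2 : Fin m → Fin n
  ep_ne : ∀ k, ep1 k ≠ ep2 k
  B : Fin m → ℝ
  B_pos : ∀ k, 0 < B k
  Bii : Vec n
  Xd : Vec n
  Xd' : Vec n
  M : Vec n
  A : Vec n
  T : Vec n
  q : Vec n
  M_pos : ∀ i, 0 < M i
  A_pos : ∀ i, 0 < A i
  T_pos : ∀ i, 0 < T i
  q_pos : ∀ i, 0 < q i
  L : Matrix (Fin n) (Fin n) ℝ
  L_posSemidef : L.PosSemidef
  L_ker : ∀ ψ, L *ᵥ ψ = 0 → ∀ i j, ψ i = ψ j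
  S : Matrix (Fin r) (Fin r) ℝ
  R : Fin r → ℝ
  S_skew : Sᵀ = -S
  S_det : IsUnit S.det
  observable : ∀ x : Fin r → ℝ, (∀ j < r, R ⬝ᵥ (S ^ j *ᵥ x) = 0) → x = 0
  ηb : Vec m
  Vb : Vec n
  Vb_pos : ∀ i, 0 < Vb i
  cos_pos : ∀ k, 0 < Real.cos (ηb k)
  schur_posDef : (Schur ep1 ep2 B Bii Xd Xd' ηb Vb).PosDef
  Efd : Vec n
  Emat_mulVec_Vb : Emat ep1 ep2 B Bii Xd Xd' ηb *ᵥ Vb = Efd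

/-- States `((η, V), (ω, θ₁ - θ̄₁, θ₂ - θ̄₂))` of the error system. -/
abbrev ErrorState (n m r : ℕ) := (Vec m × Vec n) × (Vec n × Vec n × (Fin n → Fin r → ℝ))

namespace ErrorSystem

variable {n m r : ℕ} (N : ErrorSystem n m r)

/-- The angle gradient of the potential. -/
abbrev gradη (p : Vec m × Vec n) : Vec m := gradAngle N.ep1 N.ep2 N.B N.ηb N.Vb p.1 p.2

/-- The voltage gradient of the potential. -/
abbrev gradV (p : Vec m × Vec n) : Vec n :=
  gradVolt N.ep1 N.ep2 N.B N.Bii N.Xd N.Xd' N.Efd p.1 p.2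

/-- The deviation of the input minus the deviation of the network power flow. -/
def imbalance (x : ErrorState n m r) : Vec n := fun i =>
  (N.q i)⁻¹ * (x.2.2.1 i + N.R ⬝ᵥ x.2.2.2 i) - (incD N.ep1 N.ep2 *ᵥ N.gradη x.1) i

/-- The vector field of the error system. -/
def field (x : ErrorState n m r) : ErrorState n m r :=
  (((incD N.ep1 N.ep2)ᵀ *ᵥ x.2.1, fun i => -((N.T i)⁻¹ * N.gradV x.1 i)),
    (fun i => (N.M i)⁻¹ * (N.imbalance x i - N.A i * x.2.1 i),
      fun i => -(N.L *ᵥ x.2.2.1) i - (N.q i)⁻¹ * x.2.1 i,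
      fun i j => (N.S *ᵥ x.2.2.2 i) j - (N.q i)⁻¹ * N.R j * x.2.1 i))

/-- The steady state. -/
def equilibrium : ErrorState n m r := ((N.ηb, N.Vb), (0, 0, 0))

/-- The Lyapunov function. -/
def lyapunov (x : ErrorState n m r) : ℝ :=
  W2 N.ep1 N.ep2 N.B N.Bii N.Xd N.Xd' N.Efd N.ηb N.Vb x.1.1 x.1.2
    + ((∑ i, 1 / 2 * (N.M i * (x.2.1 i * x.2.1 i))) + (∑ i, 1 / 2 * (x.2.2.1 i * x.2.2.1 i))
      + ∑ i, ∑ j, 1 / 2 * (x.2.2.2 i j * x.2.2.2 i j))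

/-- The rate at which the Lyapunov function decreases. -/
def dissipation (x : ErrorState n m r) : ℝ :=
  (∑ i, N.A i * x.2.1 i ^ 2) + (∑ i, (N.T i)⁻¹ * N.gradV x.1 i ^ 2)
    + x.2.2.1 ⬝ᵥ (N.L *ᵥ x.2.2.1)

theorem continuous_gradη : Continuous N.gradη :=
  continuous_gradAngle N.ep1 N.ep2 N.B N.ηb N.Vb

theorem continuous_gradV : Continuous N.gradV := by
  refine continuous_pi fun i => ?_
  simp only [gradV, gradVolt, Pi.sub_apply, Emat_mulVec N.ep_ne]
  refine Continuous.sub (Continuous.sub (by fun_prop) (continuous_finsetSum _ fun k _ => ?_))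
    continuous_const
  split_ifs <;> fun_prop

theorem continuous_imbalance : Continuous N.imbalance := by
  have := N.continuous_gradη
  unfold imbalance
  simp only [mulVec, dotProduct]
  fun_prop

theorem continuous_field : Continuous N.field := by
  have := N.continuous_gradV
  have := N.continuous_imbalance
  unfold field
  simp only [mulVec, dotProduct]
  fun_prop

theorem continuous_lyapunov : Continuous N.lyapunov := by
  unfold lyapunov W2 Gam sinv cosv Fmat
  simp only [mulVec_diagonal, dotProduct]
  fun_prop

theorem continuous_dissipation : Continuous N.dissipation := by
  have := N.continuous_gradV
  unfold dissipation
  simp only [mulVec, dotProduct]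
  fun_prop

theorem dotProduct_L_nonneg (ψ : Vec n) : 0 ≤ ψ ⬝ᵥ (N.L *ᵥ ψ) := by
  simpa using N.L_posSemidef.dotProduct_mulVec_nonneg ψ

theorem dissipation_nonneg (x : ErrorState n m r) : 0 ≤ N.dissipation x :=
  add_nonneg (add_nonneg
    (Finset.sum_nonneg fun i _ => mul_nonneg (N.A_pos i).le (sq_nonneg _))
    (Finset.sum_nonneg fun i _ => mul_nonneg (inv_pos.mpr (N.T_pos i)).le (sq_nonneg _)))
    (N.dotProduct_L_nonneg _)

theorem of_dissipation_eq_zero {x : ErrorState n m r} (h : N.dissipation x = 0) :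
    x.2.1 = 0 ∧ N.gradV x.1 = 0 ∧ N.L *ᵥ x.2.2.1 = 0 := by
  have h1 : ∀ i ∈ Finset.univ, 0 ≤ N.A i * x.2.1 i ^ 2 := fun i _ =>
    mul_nonneg (N.A_pos i).le (sq_nonneg _)
  have h2 : ∀ i ∈ Finset.univ, 0 ≤ (N.T i)⁻¹ * N.gradV x.1 i ^ 2 := fun i _ =>
    mul_nonneg (inv_pos.mpr (N.T_pos i)).le (sq_nonneg _)
  have h3 := N.dotProduct_L_nonneg x.2.2.1
  have h1' := Finset.sum_nonneg h1
  have h2' := Finset.sum_nonneg h2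
  unfold dissipation at h
  refine ⟨funext fun i => ?_, funext fun i => ?_, ?_⟩
  · have := (Finset.sum_eq_zero_iff_of_nonneg h1).mp (by linarith) i (Finset.mem_univ i)
    simpa [(N.A_pos i).ne'] using this
  · have := (Finset.sum_eq_zero_iff_of_nonneg h2).mp (by linarith) i (Finset.mem_univ i)
    simpa [(N.T_pos i).ne'] using this
  · exact (N.L_posSemidef.dotProduct_mulVec_zero_iff _).mp (by rw [star_trivial]; linarith)

theorem exists_forall_dist_le_lyapunov_lt :
    ∃ ρ > 0, ∀ x, x ≠ N.equilibrium → dist x N.equilibrium ≤ ρ →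
      N.lyapunov N.equilibrium < N.lyapunov x := by
  obtain ⟨ρ, hρ, h⟩ := exists_forall_dist_le_W2_lt N.B N.Bii N.Xd N.Xd' N.Efd N.ηb N.Vb N.ep_ne
    N.B_pos N.Vb_pos N.cos_pos N.schur_posDef N.Emat_mulVec_Vb
  refine ⟨ρ, hρ, fun x hx hd => ?_⟩
  have h1 : ∀ i ∈ Finset.univ, 0 ≤ 1 / 2 * (N.M i * (x.2.1 i * x.2.1 i)) := fun i _ =>
    mul_nonneg (by norm_num) (mul_nonneg (N.M_pos i).le (mul_self_nonneg _))
  have h2 : ∀ i ∈ Finset.univ, 0 ≤ 1 / 2 * (x.2.2.1 i * x.2.2.1 i) := fun i _ =>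
    mul_nonneg (by norm_num) (mul_self_nonneg _)
  have h3' : ∀ i, ∀ j ∈ Finset.univ, 0 ≤ 1 / 2 * (x.2.2.2 i j * x.2.2.2 i j) := fun i j _ =>
    mul_nonneg (by norm_num) (mul_self_nonneg _)
  have h3 : ∀ i ∈ Finset.univ, 0 ≤ ∑ j, 1 / 2 * (x.2.2.2 i j * x.2.2.2 i j) := fun i _ =>
    Finset.sum_nonneg (h3' i)
  have hs1 := Finset.sum_nonneg h1
  have hs2 := Finset.sum_nonneg h2
  have hs3 := Finset.sum_nonneg h3
  have heq : N.lyapunov N.equilibrium =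
      W2 N.ep1 N.ep2 N.B N.Bii N.Xd N.Xd' N.Efd N.ηb N.Vb N.ηb N.Vb := by
    simp [lyapunov, equilibrium]
  rw [heq, lyapunov]
  by_cases hp : x.1 = (N.ηb, N.Vb)
  · rw [hp]
    by_contra! hcon
    refine hx (Prod.ext hp (Prod.ext (funext fun i => ?_) (Prod.ext (funext fun i => ?_)
      (funext fun i => funext fun j => ?_))))
    · have := (Finset.sum_eq_zero_iff_of_nonneg h1).mp (by linarith) i (Finset.mem_univ i)
      simpa [(N.M_pos i).ne', equilibrium] using this
    · have := (Finset.sum_eq_zero_iff_of_nonneg h2).mp (by linarith) i (Finset.mem_univ i)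
      simpa [equilibrium] using this
    · have := (Finset.sum_eq_zero_iff_of_nonneg (h3' i)).mp
        ((Finset.sum_eq_zero_iff_of_nonneg h3).mp (by linarith) i (Finset.mem_univ i))
        j (Finset.mem_univ j)
      simpa [equilibrium] using this
  · have := h x.1 hp ((le_max_left _ _).trans hd)
    linarith

section Trajectory

variable {N} {z : ℝ → ErrorState n m r}

theorem hasDerivAt_angle (hz : ∀ t, HasDerivAt z (N.field (z t)) t) (t : ℝ) :
    HasDerivAt (fun s => (z s).1.1) ((incD N.ep1 N.ep2)ᵀ *ᵥ (z t).2.1) t :=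
  (hz t).fst.fst

theorem hasDerivAt_voltage (hz : ∀ t, HasDerivAt z (N.field (z t)) t) (t : ℝ) :
    HasDerivAt (fun s => (z s).1.2) (fun i => -((N.T i)⁻¹ * N.gradV (z t).1 i)) t :=
  (hz t).fst.snd

theorem hasDerivAt_frequency (hz : ∀ t, HasDerivAt z (N.field (z t)) t) (t : ℝ) (i : Fin n) :
    HasDerivAt (fun s => (z s).2.1 i)
      ((N.M i)⁻¹ * (N.imbalance (z t) i - N.A i * (z t).2.1 i)) t :=
  hasDerivAt_pi.mp (hz t).snd.fst i

theorem hasDerivAt_integrator (hz : ∀ t, HasDerivAt z (N.field (z t)) t) (t : ℝ) (i : Fin n) :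
    HasDerivAt (fun s => (z s).2.2.1 i)
      (-(N.L *ᵥ (z t).2.2.1) i - (N.q i)⁻¹ * (z t).2.1 i) t :=
  hasDerivAt_pi.mp (hz t).snd.snd.fst i

theorem hasDerivAt_oscillator (hz : ∀ t, HasDerivAt z (N.field (z t)) t)
    (t : ℝ) (i : Fin n) (j : Fin r) :
    HasDerivAt (fun s => (z s).2.2.2 i j)
      ((N.S *ᵥ (z t).2.2.2 i) j - (N.q i)⁻¹ * N.R j * (z t).2.1 i) t :=
  hasDerivAt_pi.mp (hasDerivAt_pi.mp (hz t).snd.snd.snd i) j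

theorem hasDerivAt_dotProduct_oscillator (hz : ∀ t, HasDerivAt z (N.field (z t)) t)
    (t : ℝ) (i : Fin n) (c : Fin r → ℝ) :
    HasDerivAt (fun s => c ⬝ᵥ (z s).2.2.2 i)
      (c ⬝ᵥ (N.S *ᵥ (z t).2.2.2 i) - (N.q i)⁻¹ * (c ⬝ᵥ N.R) * (z t).2.1 i) t := by
  convert! HasDerivAt.fun_sum (u := Finset.univ) fun j _ =>
    (hasDerivAt_oscillator hz t i j).const_mul (c j) using 1
  simp only [dotProduct, mul_sub, Finset.sum_sub_distrib, Finset.mul_sum, Finset.sum_mul]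
  congr 1
  exact Finset.sum_congr rfl fun j _ => by ring

theorem hasDerivAt_lyapunov (hz : ∀ t, HasDerivAt z (N.field (z t)) t) (t : ℝ) :
    HasDerivAt (fun s => N.lyapunov (z s)) (-N.dissipation (z t)) t := by
  have h := (hasDerivAt_W2 N.B N.Bii N.Xd N.Xd' N.Efd N.ηb N.Vb N.ep_ne
    (hasDerivAt_angle hz t) (hasDerivAt_voltage hz t)).add
    (((HasDerivAt.fun_sum (u := Finset.univ) fun i _ =>
      (((hasDerivAt_frequency hz t i).mul (hasDerivAt_frequency hz t i)).const_mul
        (N.M i)).const_mul (1 / 2)).add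
    (HasDerivAt.fun_sum (u := Finset.univ) fun i _ =>
      ((hasDerivAt_integrator hz t i).mul (hasDerivAt_integrator hz t i)).const_mul
        (1 / 2))).add
    (HasDerivAt.fun_sum (u := Finset.univ) fun i _ =>
      HasDerivAt.fun_sum (u := Finset.univ) fun j _ =>
      ((hasDerivAt_oscillator hz t i j).mul (hasDerivAt_oscillator hz t i j)).const_mul
        (1 / 2)))
  convert! h using 1
  generalize z t = x
  obtain ⟨p, ω, ψ, ξ⟩ := x
  have hη : N.gradη p ⬝ᵥ ((incD N.ep1 N.ep2)ᵀ *ᵥ ω) =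
      ∑ i, (incD N.ep1 N.ep2 *ᵥ N.gradη p) i * ω i := by
    rw [mulVec_transpose, dotProduct_comm, ← dotProduct_mulVec, dotProduct_comm]
    rfl
  have hV : N.gradV p ⬝ᵥ (fun i => -((N.T i)⁻¹ * N.gradV p i)) =
      -∑ i, (N.T i)⁻¹ * N.gradV p i ^ 2 := by
    rw [dotProduct, ← Finset.sum_neg_distrib]
    exact Finset.sum_congr rfl fun i _ => by ring
  have hψ : ψ ⬝ᵥ (N.L *ᵥ ψ) = ∑ i, ψ i * (N.L *ᵥ ψ) i := rfl
  have hξ (i : Fin n) : ∑ j, 1 / 2 * (((N.S *ᵥ ξ i) j - (N.q i)⁻¹ * N.R j * ω i) * ξ i j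
      + ξ i j * ((N.S *ᵥ ξ i) j - (N.q i)⁻¹ * N.R j * ω i)) =
      -((N.q i)⁻¹ * (N.R ⬝ᵥ ξ i) * ω i) := by
    have h0 := dotProduct_mulVec_self_eq_zero_of_skew N.S_skew (ξ i)
    rw [← zero_sub, ← h0]
    simp only [dotProduct, Finset.mul_sum, Finset.sum_mul, ← Finset.sum_sub_distrib]
    exact Finset.sum_congr rfl fun j _ => by ring
  simp only [dissipation, hη, hV, hψ, hξ, imbalance]
  rw [← sub_eq_zero]
  simp only [← Finset.sum_add_distrib, ← Finset.sum_sub_distrib, ← Finset.sum_neg_distrib]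
  refine Finset.sum_eq_zero fun i _ => ?_
  have := (N.M_pos i).ne'
  field_simp
  ring

theorem hasDerivAt_imbalance (hz : ∀ t, HasDerivAt z (N.field (z t)) t) (t : ℝ) (i : Fin n) :
    HasDerivAt (fun s => N.imbalance (z s) i)
      ((N.q i)⁻¹ * (-(N.L *ᵥ (z t).2.2.1) i - (N.q i)⁻¹ * (z t).2.1 i
        + (N.R ⬝ᵥ (N.S *ᵥ (z t).2.2.2 i) - (N.q i)⁻¹ * (N.R ⬝ᵥ N.R) * (z t).2.1 i))
      - ∑ k, incD N.ep1 N.ep2 i k * (N.B k *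
        ((-((N.T (N.ep1 k))⁻¹ * N.gradV (z t).1 (N.ep1 k)) * (z t).1.2 (N.ep2 k)
          + (z t).1.2 (N.ep1 k) * -((N.T (N.ep2 k))⁻¹ * N.gradV (z t).1 (N.ep2 k)))
            * Real.sin ((z t).1.1 k)
        + (z t).1.2 (N.ep1 k) * (z t).1.2 (N.ep2 k) * (Real.cos ((z t).1.1 k)
            * ((incD N.ep1 N.ep2)ᵀ *ᵥ (z t).2.1) k)))) t :=
  (((hasDerivAt_integrator hz t i).add
    (hasDerivAt_dotProduct_oscillator hz t i N.R)).const_mul _).sub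
    (HasDerivAt.fun_sum (u := Finset.univ) fun k _ =>
      (hasDerivAt_gradAngle N.ep1 N.ep2 N.B N.ηb N.Vb (hasDerivAt_angle hz t)
        (hasDerivAt_voltage hz t) k).const_mul (incD N.ep1 N.ep2 i k))

variable {ρ : ℝ}

theorem eq_zero_of_mapClusterPt (hz : ∀ t, HasDerivAt z (N.field (z t)) t)
    (hρ : ∀ t, 0 ≤ t → dist (z t) N.equilibrium ≤ ρ)
    {f : ℝ → ℝ} {a : ErrorState n m r → ℝ} (ha : Continuous a)
    (hf : ∀ t, HasDerivAt f (a (z t)) t) {c : ℝ} (hfc : Tendsto f atTop (𝓝 c))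
    {x : ErrorState n m r} (hx : MapClusterPt x atTop z) : a x = 0 :=
  eq_zero_of_mapClusterPt_of_hasDerivAt (isCompact_closedBall N.equilibrium ρ) hρ
    N.continuous_field hz ha hf hfc hx

theorem dissipation_eq_zero_of_mapClusterPt (hz : ∀ t, HasDerivAt z (N.field (z t)) t)
    (hρ : ∀ t, 0 ≤ t → dist (z t) N.equilibrium ≤ ρ)
    {x : ErrorState n m r}
    (hx : MapClusterPt x atTop z) : N.dissipation x = 0 := by
  have hanti : Antitone fun t => N.lyapunov (z t) :=
    antitone_of_hasDerivAt_nonpos (hasDerivAt_lyapunov hz)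
      fun t => neg_nonpos.mpr (N.dissipation_nonneg _)
  obtain ⟨C, hC⟩ := (isCompact_closedBall N.equilibrium ρ).exists_bound_of_continuousOn
    N.continuous_lyapunov.continuousOn
  rcases tendsto_atTop_of_antitone hanti with h | ⟨l, hl⟩
  · obtain ⟨t, ht0, ht⟩ := ((eventually_ge_atTop (0 : ℝ)).and
      (h.eventually (eventually_lt_atBot (-C)))).exists
    have := (abs_le.mp (hC _ (hρ t ht0))).1
    linarith
  · exact neg_eq_zero.mp (eq_zero_of_mapClusterPt hz hρ N.continuous_dissipation.neg
      (hasDerivAt_lyapunov hz) hl hx)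

theorem frequency_eq_zero_of_mapClusterPt (hz : ∀ t, HasDerivAt z (N.field (z t)) t)
    (hρ : ∀ t, 0 ≤ t → dist (z t) N.equilibrium ≤ ρ)
    {x : ErrorState n m r}
    (hx : MapClusterPt x atTop z) : x.2.1 = 0 :=
  (N.of_dissipation_eq_zero (dissipation_eq_zero_of_mapClusterPt hz hρ hx)).1

theorem imbalance_eq_zero_of_mapClusterPt (hz : ∀ t, HasDerivAt z (N.field (z t)) t)
    (hρ : ∀ t, 0 ≤ t → dist (z t) N.equilibrium ≤ ρ)
    {x : ErrorState n m r}
    (hx : MapClusterPt x atTop z) (i : Fin n) : N.imbalance x i = 0 := by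
  have hω := frequency_eq_zero_of_mapClusterPt hz hρ hx
  have hc := N.continuous_imbalance
  have h := eq_zero_of_mapClusterPt hz hρ
    (a := fun x => (N.M i)⁻¹ * (N.imbalance x i - N.A i * x.2.1 i)) (by fun_prop)
    (fun t => hasDerivAt_frequency hz t i)
    (tendsto_comp_of_mapClusterPt (isCompact_closedBall N.equilibrium ρ) hρ
      (φ := fun x => x.2.1 i) (by fun_prop)
      fun y hy => congrFun (frequency_eq_zero_of_mapClusterPt hz hρ hy) i) hx
  simpa [hω, (N.M_pos i).ne'] using h

theorem output_eq_zero_of_mapClusterPt (hz : ∀ t, HasDerivAt z (N.field (z t)) t)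
    (hρ : ∀ t, 0 ≤ t → dist (z t) N.equilibrium ≤ ρ)
    {x : ErrorState n m r}
    (hx : MapClusterPt x atTop z) (i : Fin n) (j : ℕ) :
    N.R ⬝ᵥ (N.S ^ j *ᵥ (N.S *ᵥ x.2.2.2 i)) = 0 := by
  induction j generalizing x with
  | zero =>
    obtain ⟨hω, hV, hL⟩ :=
      N.of_dissipation_eq_zero (dissipation_eq_zero_of_mapClusterPt hz hρ hx)
    have hc := N.continuous_imbalance
    have hcV := N.continuous_gradV
    have h := eq_zero_of_mapClusterPt hz hρ
      (a := fun x => (N.q i)⁻¹ * (-(N.L *ᵥ x.2.2.1) i - (N.q i)⁻¹ * x.2.1 i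
        + (N.R ⬝ᵥ (N.S *ᵥ x.2.2.2 i) - (N.q i)⁻¹ * (N.R ⬝ᵥ N.R) * x.2.1 i))
      - ∑ k, incD N.ep1 N.ep2 i k * (N.B k *
        ((-((N.T (N.ep1 k))⁻¹ * N.gradV x.1 (N.ep1 k)) * x.1.2 (N.ep2 k)
          + x.1.2 (N.ep1 k) * -((N.T (N.ep2 k))⁻¹ * N.gradV x.1 (N.ep2 k)))
            * Real.sin (x.1.1 k)
        + x.1.2 (N.ep1 k) * x.1.2 (N.ep2 k) * (Real.cos (x.1.1 k)
            * ((incD N.ep1 N.ep2)ᵀ *ᵥ x.2.1) k))))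
      (by simp only [mulVec, dotProduct]; fun_prop) (fun t => hasDerivAt_imbalance hz t i)
      (tendsto_comp_of_mapClusterPt (isCompact_closedBall N.equilibrium ρ) hρ
        (φ := fun x => N.imbalance x i) (by fun_prop)
        fun y hy => imbalance_eq_zero_of_mapClusterPt hz hρ hy i) hx
    simpa [hω, hV, hL, (N.q_pos i).ne'] using h
  | succ j ih =>
    have hω := frequency_eq_zero_of_mapClusterPt hz hρ hx
    set c : Fin r → ℝ := N.R ᵥ* (N.S ^ j * N.S) with hcdef
    have hdot (v : Fin r → ℝ) : N.R ⬝ᵥ (N.S ^ j *ᵥ (N.S *ᵥ v)) = c ⬝ᵥ v := by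
      rw [mulVec_mulVec, dotProduct_mulVec]
    have h := eq_zero_of_mapClusterPt hz hρ
      (a := fun x => c ⬝ᵥ (N.S *ᵥ x.2.2.2 i) - (N.q i)⁻¹ * (c ⬝ᵥ N.R) * x.2.1 i)
      (by simp only [mulVec, dotProduct]; fun_prop)
      (fun t => hasDerivAt_dotProduct_oscillator hz t i c)
      (tendsto_comp_of_mapClusterPt (isCompact_closedBall N.equilibrium ρ) hρ
        (φ := fun x => c ⬝ᵥ x.2.2.2 i)
        (by simp only [dotProduct]; fun_prop) fun y hy => by rw [← hdot]; exact ih hy) hx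
    rw [← hdot] at h
    simpa [hω, pow_succ, ← mulVec_mulVec] using h

theorem oscillator_eq_zero_of_mapClusterPt (hz : ∀ t, HasDerivAt z (N.field (z t)) t)
    (hρ : ∀ t, 0 ≤ t → dist (z t) N.equilibrium ≤ ρ)
    {x : ErrorState n m r}
    (hx : MapClusterPt x atTop z) : x.2.2.2 = 0 := by
  funext i
  have h := N.observable _ fun j _ => output_eq_zero_of_mapClusterPt hz hρ hx i j
  exact mulVec_injective_of_isUnit ((isUnit_iff_isUnit_det _).mpr N.S_det)
    (h.trans (mulVec_zero _).symm)

theorem integrator_eq_zero_of_mapClusterPt (hz : ∀ t, HasDerivAt z (N.field (z t)) t)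
    (hρ : ∀ t, 0 ≤ t → dist (z t) N.equilibrium ≤ ρ)
    {x : ErrorState n m r}
    (hx : MapClusterPt x atTop z) : x.2.2.1 = 0 := by
  have hL := (N.of_dissipation_eq_zero (dissipation_eq_zero_of_mapClusterPt hz hρ hx)).2.2
  have hξ := oscillator_eq_zero_of_mapClusterPt hz hρ hx
  funext i
  have hsum : ∑ j, N.imbalance x j = 0 :=
    Finset.sum_eq_zero fun j _ => imbalance_eq_zero_of_mapClusterPt hz hρ hx j
  have hsum' : (∑ j, (N.q j)⁻¹) * x.2.2.1 i = 0 := by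
    rw [← hsum]
    simp only [imbalance, Finset.sum_sub_distrib, sum_incD_mulVec N.ep_ne, sub_zero, hξ,
      Pi.zero_apply, dotProduct_zero, add_zero, Finset.sum_mul]
    exact Finset.sum_congr rfl fun j _ => by rw [N.L_ker _ hL i j]
  exact (mul_eq_zero.mp hsum').resolve_left
    (Finset.sum_pos (fun j _ => inv_pos.mpr (N.q_pos j)) ⟨i, Finset.mem_univ i⟩).ne'

end Trajectory

/-- Local convergence of the error system to the set where frequency and controller deviations
vanish. -/
theorem exists_forall_tendsto : ∃ ε > 0, ∀ z : ℝ → ErrorState n m r,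
    (∀ t, HasDerivAt z (N.field (z t)) t) → dist (z 0) N.equilibrium < ε →
      Tendsto (fun t => (z t).2) atTop (𝓝 0) := by
  obtain ⟨ρ, hρ, hmin⟩ := N.exists_forall_dist_le_lyapunov_lt
  obtain ⟨ε, hε, h⟩ := exists_forall_dist_le_of_strict_min N.continuous_lyapunov
    (x₀ := N.equilibrium) hρ fun x hx => hmin x (dist_pos.mp (hx ▸ hρ)) hx.le
  refine ⟨ε, hε, fun z hz h0 => ?_⟩
  have hanti : Antitone fun t => N.lyapunov (z t) :=
    antitone_of_hasDerivAt_nonpos (hasDerivAt_lyapunov hz)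
      fun t => neg_nonpos.mpr (N.dissipation_nonneg _)
  have hzρ := h z (continuous_iff_continuousAt.mpr fun t => (hz t).continuousAt)
    (fun t ht => hanti ht) h0
  exact tendsto_comp_of_mapClusterPt (isCompact_closedBall N.equilibrium ρ) hzρ continuous_snd
    fun x hx => Prod.ext (frequency_eq_zero_of_mapClusterPt hz hzρ hx)
      (Prod.ext (integrator_eq_zero_of_mapClusterPt hz hzρ hx)
        (oscillator_eq_zero_of_mapClusterPt hz hzρ hx))

end ErrorSystem

/-- Theorem 3: optimal frequency regulation under time-varying demand
`Pˡ(t) = Π₁σ₁ + Q⁻¹1R₂σ₂(t)` with an observable skew-symmetric exosystem: solutions of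
the closed loop starting sufficiently close to the steady state satisfy `ω(t) → 0` and
`u(t) − ū(t) → 0`, where `ū(t) = Q⁻¹(11ᵀPˡ(t))/(1ᵀQ⁻¹1)`. -/
theorem optimal_frequency_regulation_time_varying_demand
    {n m r : ℕ} (ep1 ep2 : Fin m → Fin n) (hep : ∀ k, ep1 k ≠ ep2 k)
    (B : Fin m → ℝ) (hB : ∀ k, 0 < B k)
    (Bii Xd Xd' : Vec n)
    (Md Ad Td : Vec n) (hM : ∀ i, 0 < Md i) (hA : ∀ i, 0 < Ad i) (hT : ∀ i, 0 < Td i)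
    (q : Vec n) (hq : ∀ i, 0 < q i)
    (G : SimpleGraph (Fin n)) [DecidableRel G.Adj] (hG : G.Connected)
    (Efd : Vec n)
    -- the exosystem generating the demand
    (π1 : Vec n) (σ1 : ℝ)
    (S2 : Matrix (Fin r) (Fin r) ℝ) (R2 : Fin r → ℝ)
    (hS2skew : S2ᵀ = -S2) (hS2inv : IsUnit S2.det)
    (hobs : ∀ x : Fin r → ℝ, (∀ j < r, R2 ⬝ᵥ (S2 ^ j).mulVec x = 0) → x = 0)
    (σ2 : ℝ → Fin r → ℝ) (hσ2 : ∀ t, HasDerivAt σ2 (S2.mulVec (σ2 t)) t)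
    (Pl : ℝ → Vec n)
    (hPl : ∀ t, Pl t = fun i => π1 i * σ1 + (q i)⁻¹ * (R2 ⬝ᵥ σ2 t))
    -- solution of the regulator equations (Assumptions 3 and 4)
    (ηb : Vec m) (hηbr : ∃ δ : Vec n, ηb = (incD ep1 ep2)ᵀ.mulVec δ)
    (Vb : Vec n) (hVb : ∀ i, 0 < Vb i)
    (hfeas : ∀ t, (fun i => (q i)⁻¹ * ((∑ j, Pl t j) / (∑ j, (q j)⁻¹)) - Pl t i)
      = (incD ep1 ep2).mulVec ((Gam ep1 ep2 B Vb).mulVec (sinv ηb)))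
    (hEfd : (Emat ep1 ep2 B Bii Xd Xd' ηb).mulVec Vb = Efd)
    (hsec : ∀ k, ηb k ∈ Set.Ioo (-(π / 2)) (π / 2))
    (hPD : (Schur ep1 ep2 B Bii Xd Xd' ηb Vb).PosDef) :
    ∃ ε > (0:ℝ),
      ∀ (η : ℝ → Vec m) (ω ω' V V' θ1 : ℝ → Vec n) (θ2 : ℝ → Fin n → Fin r → ℝ),
        (∀ t, HasDerivAt η ((incD ep1 ep2)ᵀ.mulVec (ω t)) t) →
        (∀ t, HasDerivAt ω (ω' t) t) →
        (∀ t, (Matrix.diagonal Md).mulVec (ω' t)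
          = (fun i => (q i)⁻¹ * θ1 t i + (q i)⁻¹ * (R2 ⬝ᵥ θ2 t i))
            - (incD ep1 ep2).mulVec ((Gam ep1 ep2 B (V t)).mulVec (sinv (η t)))
            - (Matrix.diagonal Ad).mulVec (ω t) - Pl t) →
        (∀ t, HasDerivAt V (V' t) t) →
        (∀ t, (Matrix.diagonal Td).mulVec (V' t)
          = -(Emat ep1 ep2 B Bii Xd Xd' (η t)).mulVec (V t) + Efd) →
        (∀ t, HasDerivAt θ1
          (-(G.lapMatrix ℝ).mulVec (θ1 t)
            - (Matrix.diagonal fun i => (q i)⁻¹).mulVec (ω t)) t) →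
        (∀ t, HasDerivAt θ2
          (fun i j => (S2.mulVec (θ2 t i)) j - (q i)⁻¹ * R2 j * ω t i) t) →
        (dist (η 0) ηb < ε ∧ dist (ω 0) 0 < ε ∧ dist (V 0) Vb < ε ∧
          dist (θ1 0) (fun _ => (∑ j, π1 j * σ1) / (∑ j, (q j)⁻¹)) < ε ∧
          dist (θ2 0) (fun _ => σ2 0) < ε) →
        Filter.Tendsto ω Filter.atTop (𝓝 0) ∧
        Filter.Tendsto
          (fun t => (fun i => (q i)⁻¹ * θ1 t i + (q i)⁻¹ * (R2 ⬝ᵥ θ2 t i))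
            - fun i => (q i)⁻¹ * ((∑ j, Pl t j) / (∑ j, (q j)⁻¹)))
          Filter.atTop (𝓝 0) := by
  have hinv : 0 < ∑ j, (q j)⁻¹ := by
    obtain ⟨i⟩ := hG.nonempty
    exact Finset.sum_pos (fun j _ => inv_pos.mpr (hq j)) ⟨i, Finset.mem_univ i⟩
  let N : ErrorSystem n m r :=
    { ep1 := ep1, ep2 := ep2, ep_ne := hep, B := B, B_pos := hB, Bii := Bii, Xd := Xd, Xd' := Xd',
      M := Md, A := Ad, T := Td, q := q, M_pos := hM, A_pos := hA, T_pos := hT, q_pos := hq,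
      L := G.lapMatrix ℝ, L_posSemidef := G.posSemidef_lapMatrix ℝ,
      L_ker := fun ψ hψ i j => (G.lapMatrix_mulVec_eq_zero_iff_forall_reachable.mp hψ) i j
        (hG.preconnected i j)
      S := S2, R := R2, S_skew := hS2skew, S_det := hS2inv, observable := hobs, ηb := ηb, Vb := Vb,
      Vb_pos := hVb, cos_pos := fun k => Real.cos_pos_of_mem_Ioo (hsec k), schur_posDef := hPD,
      Efd := Efd, Emat_mulVec_Vb := hEfd }
  set c : ℝ := (∑ j, π1 j * σ1) / ∑ j, (q j)⁻¹ with hc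
  have hopt (t : ℝ) : (∑ j, Pl t j) / (∑ j, (q j)⁻¹) = c + R2 ⬝ᵥ σ2 t := by
    simp only [hPl, Finset.sum_add_distrib, ← Finset.sum_mul, hc]
    rw [add_div, mul_div_cancel_left₀ _ hinv.ne']
  have hPl_eq (t : ℝ) (i : Fin n) : Pl t i = (q i)⁻¹ * (c + R2 ⬝ᵥ σ2 t)
      - (incD ep1 ep2 *ᵥ (Gam ep1 ep2 B Vb *ᵥ sinv ηb)) i := by
    rw [← hfeas t, hopt]
    ring
  obtain ⟨ε, hε, hconv⟩ := N.exists_forall_tendsto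
  refine ⟨ε, hε, fun η ω ω' V V' θ1 θ2 hη hω hω' hV hV' hθ1 hθ2 h0 => ?_⟩
  let z : ℝ → ErrorState n m r := fun t =>
    ((η t, V t), (ω t, θ1 t - (fun _ => c), θ2 t - fun _ => σ2 t))
  have hσ : ∀ t, HasDerivAt (fun t (_ : Fin n) => σ2 t) (fun _ => S2 *ᵥ σ2 t) t := fun t =>
    hasDerivAt_pi.mpr fun _ => hσ2 t
  have hz : ∀ t, HasDerivAt z (N.field (z t)) t := fun t => by
    convert! ((hη t).prodMk (hV t)).prodMk
      ((hω t).prodMk (((hθ1 t).sub_const (fun _ => c)).prodMk ((hθ2 t).sub (hσ t)))) using 1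
    refine Prod.ext (Prod.ext rfl (funext fun i => ?_)) (Prod.ext (funext fun i => ?_)
      (Prod.ext (funext fun i => ?_) (funext fun i => funext fun j => ?_)))
    · have h := congrFun (hV' t) i
      simp only [mulVec_diagonal, Pi.add_apply, Pi.neg_apply] at h
      have := (hT i).ne'
      change -((Td i)⁻¹ * ((Emat ep1 ep2 B Bii Xd Xd' (η t) *ᵥ V t) i - Efd i)) = V' t i
      field_simp
      linarith
    · have h := congrFun (hω' t) i
      simp only [mulVec_diagonal, Pi.sub_apply, hPl_eq] at h
      have := (hM i).ne'
      have hD : (incD ep1 ep2 *ᵥ gradAngle ep1 ep2 B ηb Vb (η t) (V t)) i =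
          (incD ep1 ep2 *ᵥ (Gam ep1 ep2 B (V t) *ᵥ sinv (η t))) i
            - (incD ep1 ep2 *ᵥ (Gam ep1 ep2 B Vb *ᵥ sinv ηb)) i := by
        rw [gradAngle, mulVec_sub, Pi.sub_apply]
      change (Md i)⁻¹ * ((q i)⁻¹ * (θ1 t i - c + R2 ⬝ᵥ (θ2 t i - σ2 t))
        - (incD ep1 ep2 *ᵥ gradAngle ep1 ep2 B ηb Vb (η t) (V t)) i - Ad i * ω t i) = ω' t i
      rw [hD, dotProduct_sub, inv_mul_eq_iff_eq_mul₀ this, h]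
      ring
    · have hconst : G.lapMatrix ℝ *ᵥ (fun _ => c) = 0 :=
        G.lapMatrix_mulVec_eq_zero_iff_forall_adj.mpr fun _ _ _ => rfl
      change -(G.lapMatrix ℝ *ᵥ (θ1 t - fun _ => c)) i - (q i)⁻¹ * ω t i = _
      rw [mulVec_sub, hconst, sub_zero]
      simp [mulVec_diagonal]
    · change (S2 *ᵥ (θ2 t i - σ2 t)) j - (q i)⁻¹ * R2 j * ω t i = _
      rw [mulVec_sub]
      simp only [Pi.sub_apply]
      ring
  have hlim : Tendsto (fun t => (z t).2) atTop (𝓝 0) := by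
    refine hconv z hz ?_
    obtain ⟨h1, h2, h3, h4, h5⟩ := h0
    refine max_lt (max_lt h1 h3) (max_lt h2 (max_lt ?_ ?_))
    · change dist (θ1 0 - fun _ => c) 0 < ε
      rwa [dist_zero_right, ← dist_eq_norm]
    · change dist (θ2 0 - fun _ => σ2 0) 0 < ε
      rwa [dist_zero_right, ← dist_eq_norm]
  refine ⟨hlim.fst_nhds, ?_⟩
  have hcont : Continuous fun y : Vec n × Vec n × (Fin n → Fin r → ℝ) =>
      fun i => (q i)⁻¹ * y.2.1 i + (q i)⁻¹ * (R2 ⬝ᵥ y.2.2 i) := by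
    simp only [dotProduct]
    fun_prop
  convert (hcont.tendsto 0).comp hlim using 1
  · funext t i
    simp only [Pi.sub_apply, Function.comp_apply, hopt, z, dotProduct_sub]
    ring
  · congr 1
    funext i
    simp
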